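/- arXiv:1703.08879 — 2 statements merged into one kernel-verified Lean document; each statement's English description precedes it below -/
import Mathlib

section
/- Let X be a Polish space and let U ⊆ X be a nonempty open set. Then the annihilator 𝓝(U) = {μ ∈ 𝓜(X) : μ(U) = 0} is closed and nowhere dense in 𝓜(X); in particular, no nonempty open subset of X is residually null. -/
open MeasureTheory Set Topology
open scoped ENNReal symmDiff

/-- The annihilator of a set `A`: the set of Borel probability measures `μ` on `X`
whose induced outer measure vanishes on `A`. -/
def Annihilator {X : Type*} [MeasurableSpace X] (A : Set X) :
    Set (ProbabilityMeasure X) :=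
  {μ : ProbabilityMeasure X | μ.toMeasure A = 0}

/-- `A` is residually null if its annihilator is comeager in the space `𝓜(X)` of
Borel probability measures with the topology of weak convergence. -/
def ResiduallyNull {X : Type*} [TopologicalSpace X] [MeasurableSpace X]
    [OpensMeasurableSpace X] (A : Set X) : Prop :=
  Annihilator A ∈ residual (ProbabilityMeasure X)

/-- A set of measures on a complete metric space is tight as soon as, for all `r` and `ε`, all its
members are concentrated, up to mass `ε`, on the `r`-thickening of one compact set. -/
theorem isTightMeasureSet_of_forall_exists_isCompact_thickening {X : Type*} [MetricSpace X]
    [CompleteSpace X] [MeasurableSpace X] {S : Set (Measure X)}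
    (h : ∀ r : ℝ, 0 < r → ∀ ε : ℝ≥0∞, 0 < ε →
      ∃ K : Set X, IsCompact K ∧ ∀ μ ∈ S, μ (Metric.thickening r K)ᶜ ≤ ε) :
    IsTightMeasureSet S := by
  rw [isTightMeasureSet_iff_exists_isCompact_measure_compl_le]
  intro ε hε
  obtain ⟨δ, hδ, hsum⟩ := ENNReal.exists_pos_sum_of_countable' hε.ne' ℕ
  choose K hK hKS using fun n : ℕ ↦ h (1 / (n + 1)) (by positivity) (δ n) (hδ n)
  refine ⟨⋂ n : ℕ, Metric.cthickening (1 / (n + 1)) (K n), ?_, fun μ hμ ↦ ?_⟩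
  · refine TotallyBounded.isCompact_of_isClosed ?_
      (isClosed_iInter fun n ↦ Metric.isClosed_cthickening)
    rw [Metric.totallyBounded_iff]
    intro ρ hρ
    obtain ⟨n, hn⟩ := exists_nat_one_div_lt (half_pos hρ)
    obtain ⟨t, -, ht, hcover⟩ := (hK n).finite_cover_balls (half_pos hρ)
    refine ⟨t, ht, fun x hx ↦ ?_⟩
    have hx' := Metric.cthickening_subset_thickening' (half_pos hρ) hn (K n) (mem_iInter.1 hx n)
    obtain ⟨z, hz, hxz⟩ := Metric.mem_thickening_iff.1 hx'
    obtain ⟨y, hy, hzy⟩ := mem_iUnion₂.1 (hcover hz)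
    refine mem_iUnion₂.2 ⟨y, hy, ?_⟩
    rw [Metric.mem_ball] at hzy ⊢
    linarith [dist_triangle x z y]
  · rw [compl_iInter]
    calc μ (⋃ n : ℕ, (Metric.cthickening (1 / (n + 1)) (K n))ᶜ)
        ≤ ∑' n : ℕ, μ (Metric.cthickening (1 / (n + 1)) (K n))ᶜ := measure_iUnion_le _
      _ ≤ ∑' n, δ n := ENNReal.tsum_le_tsum fun n ↦
          (measure_mono (compl_subset_compl.2 (Metric.thickening_subset_cthickening _ _))).trans
            (hKS n μ hμ)
      _ ≤ ε := hsum.le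

/-- A set of probability measures that is totally bounded for the Lévy-Prokhorov metric is tight. -/
theorem TotallyBounded.isTightMeasureSet_levyProkhorov {X : Type*} [MetricSpace X] [CompleteSpace X]
    [SecondCountableTopology X] [MeasurableSpace X] [BorelSpace X]
    {S : Set (LevyProkhorov (ProbabilityMeasure X))} (hS : TotallyBounded S) :
    IsTightMeasureSet {(μ.toMeasure : Measure X) | μ ∈ S} := by
  refine isTightMeasureSet_of_forall_exists_isCompact_thickening fun r hr ε hε ↦ ?_
  have hε2 : 0 < ε / 2 := ENNReal.half_pos hε.ne'
  set c : ℝ≥0∞ := min (ENNReal.ofReal r) (ε / 2)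
  have hc0 : 0 < c := lt_min (ENNReal.ofReal_pos.2 hr) hε2
  have hcr : c.toReal ≤ r := ENNReal.toReal_le_of_le_ofReal hr.le (min_le_left _ _)
  obtain ⟨t, ht, hcover⟩ := EMetric.totallyBounded_iff.1 hS c hc0
  have htight (ν : LevyProkhorov (ProbabilityMeasure X)) :
      ∃ K : Set X, IsCompact K ∧ (ν.toMeasure : Measure X) Kᶜ ≤ ε / 2 := by
    obtain ⟨K, hK, hνK⟩ := isTightMeasureSet_iff_exists_isCompact_measure_compl_le.1
      (isTightMeasureSet_singleton (μ := (ν.toMeasure : Measure X))) _ hε2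
    exact ⟨K, hK, hνK _ rfl⟩
  choose K hK hνK using htight
  refine ⟨⋃ ν ∈ t, K ν, ht.isCompact_biUnion fun ν _ ↦ hK ν, ?_⟩
  rintro _ ⟨μ, hμ, rfl⟩
  obtain ⟨ν, hν, hμν⟩ := mem_iUnion₂.1 (hcover hμ)
  set T := Metric.thickening r (⋃ ν ∈ t, K ν)
  have hdisj : Metric.thickening c.toReal Tᶜ ⊆ (K ν)ᶜ := by
    intro x hx hxK
    obtain ⟨z, hz, hxz⟩ := Metric.mem_thickening_iff.1 hx
    refine hz (Metric.mem_thickening_iff.2 ⟨x, mem_biUnion hν hxK, ?_⟩)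
    rw [dist_comm]
    exact hxz.trans_le hcr
  calc (μ.toMeasure : Measure X) Tᶜ
      ≤ (ν.toMeasure : Measure X) (Metric.thickening c.toReal Tᶜ) + c :=
        left_measure_le_of_levyProkhorovEDist_lt hμν
          Metric.isOpen_thickening.measurableSet.compl
    _ ≤ ε / 2 + ε / 2 :=
        add_le_add ((measure_mono hdisj).trans (hνK ν)) (min_le_right _ _)
    _ = ε := ENNReal.add_halves ε

/-- The Lévy-Prokhorov metric on the probability measures of a separable complete metric space is
complete. -/
theorem completeSpace_levyProkhorov_probabilityMeasure {X : Type*} [MetricSpace X] [CompleteSpace X]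
    [SecondCountableTopology X] [MeasurableSpace X] [BorelSpace X] :
    CompleteSpace (LevyProkhorov (ProbabilityMeasure X)) := by
  refine Metric.complete_of_cauchySeq_tendsto fun u hu ↦ ?_
  let e := LevyProkhorov.probabilityMeasureHomeomorph (Ω := X)
  have hcpt : IsCompact (closure (e.symm '' range u)) := by
    refine isCompact_closure_of_isTightMeasureSet
      (hu.totallyBounded_range.isTightMeasureSet_levyProkhorov.subset ?_)
    rintro _ ⟨_, ⟨μ, hμ, rfl⟩, rfl⟩
    exact ⟨μ, hμ, rfl⟩
  rw [← e.symm.image_closure, e.symm.isCompact_image] at hcpt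
  obtain ⟨μ, -, hμ⟩ := cauchySeq_tendsto_of_isComplete hcpt.isComplete
    (fun n ↦ subset_closure (mem_range_self n)) hu
  exact ⟨μ, hμ⟩

theorem baireSpace_probabilityMeasure {X : Type*} [TopologicalSpace X] [PolishSpace X]
    [MeasurableSpace X] [BorelSpace X] : BaireSpace (ProbabilityMeasure X) := by
  let := TopologicalSpace.upgradeIsCompletelyMetrizable X
  have : CompleteSpace (LevyProkhorov (ProbabilityMeasure X)) :=
    completeSpace_levyProkhorov_probabilityMeasure
  exact (LevyProkhorov.probabilityMeasureHomeomorph (Ω := X)).symm.baireSpace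

theorem isClosed_annihilator {X : Type*} [TopologicalSpace X] [PolishSpace X]
    [MeasurableSpace X] [BorelSpace X] {U : Set X} (hU : IsOpen U) : IsClosed (Annihilator U) := by
  let := TopologicalSpace.upgradeIsCompletelyMetrizable X
  rw [← isOpen_compl_iff, isOpen_iff_mem_nhds]
  intro μ hμ
  filter_upwards [μ.toMeasure_add_pos_gt_mem_nhds hU (pos_iff_ne_zero.2 hμ)] with ν hν hνU
  have hνU' : ν.toMeasure U = 0 := hνU
  simp [hνU'] at hν

/-- Every weak neighbourhood of `μ` contains a probability measure charging a given point. -/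
theorem exists_mem_singleton_ne_zero_of_mem_nhds {X : Type*} [TopologicalSpace X] [PolishSpace X]
    [MeasurableSpace X] [BorelSpace X] {μ : ProbabilityMeasure X} {V : Set (ProbabilityMeasure X)}
    (hV : V ∈ 𝓝 μ) (x : X) : ∃ ν ∈ V, ν.toMeasure {x} ≠ 0 := by
  let := TopologicalSpace.upgradeIsCompletelyMetrizable X
  let e := LevyProkhorov.probabilityMeasureHomeomorph (Ω := X)
  have hV' : e.symm ⁻¹' V ∈ 𝓝 (e μ) :=
    e.symm.continuous.continuousAt.preimage_mem_nhds (by simpa using hV)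
  obtain ⟨r, hr, hball⟩ := Metric.mem_nhds_iff.1 hV'
  set t : ℝ := min (r / 2) 1
  have ht0 : 0 < t := lt_min (half_pos hr) one_pos
  have ht1 : ENNReal.ofReal t ≤ 1 := ENNReal.ofReal_le_one.2 (min_le_right _ _)
  have htr : t < r := (min_le_left _ _).trans_lt (half_lt_self hr)
  let m : Measure X := (1 - ENNReal.ofReal t) • (μ : Measure X) + ENNReal.ofReal t • .dirac x
  have hm : IsProbabilityMeasure m := ⟨by simp [m, tsub_add_cancel_of_le ht1]⟩
  refine ⟨⟨m, hm⟩, @hball (e ⟨m, hm⟩) ?_, ?_⟩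
  · rw [Metric.mem_ball]
    refine lt_of_le_of_lt ?_ htr
    refine levyProkhorovDist_le_of_forall_le m μ ht0.le fun ε B hε hB ↦ ?_
    calc m B = (1 - ENNReal.ofReal t) * (μ : Measure X) B
          + ENNReal.ofReal t * Measure.dirac x B := by simp [m]
      _ ≤ 1 * (μ : Measure X) B + ENNReal.ofReal t * 1 := by
          gcongr
          · exact tsub_le_self
          · exact prob_le_one
      _ ≤ (μ : Measure X) (Metric.thickening ε B) + ENNReal.ofReal ε := by
          rw [one_mul, mul_one]
          gcongr
          exact Metric.self_subset_thickening (ht0.trans hε) B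
  · simp [m, ht0]

/-- For a nonempty open `U` in a Polish space, the annihilator of `U` is closed and
nowhere dense in `𝓜(X)`; in particular, `U` is not residually null. -/
theorem annihilator_open_closed_nowhereDense {X : Type*} [TopologicalSpace X] [PolishSpace X]
    [MeasurableSpace X] [BorelSpace X] (U : Set X) (hU : IsOpen U) (hne : U.Nonempty) :
    IsClosed (Annihilator U) ∧ IsNowhereDense (Annihilator U) ∧ ¬ ResiduallyNull U := by
  have hclosed : IsClosed (Annihilator U) := isClosed_annihilator hU
  obtain ⟨x, hx⟩ := hne
  have hnd : IsNowhereDense (Annihilator U) := by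
    rw [isNowhereDense_iff_forall_notMem_nhds, hclosed.closure_eq]
    intro μ _ hnhds
    obtain ⟨ν, hν, hνx⟩ := exists_mem_singleton_ne_zero_of_mem_nhds hnhds x
    exact hνx (measure_mono_null (singleton_subset_iff.2 hx) hν)
  refine ⟨hclosed, hnd, fun hres ↦ ?_⟩
  have := baireSpace_probabilityMeasure (X := X)
  have hdense : Dense (Annihilator U) := dense_of_mem_residual hres
  have huniv := hdense.closure_eq
  rw [IsNowhereDense, huniv, interior_univ] at hnd
  have hmem : diracProba x ∈ (univ : Set (ProbabilityMeasure X)) := mem_univ _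
  simp [hnd] at hmem
end

section
/- Let X be a Polish space. For any set A ⊆ X, both A ∩ R(A) and A ∩ cl(R(A)) are residually null, where cl denotes topological closure in X. -/
open MeasureTheory Set Topology
open scoped ENNReal symmDiff

/-- `ROp A` is the union of all open sets `U` such that `U ∩ A` is residually null. -/
def ROp {X : Type*} [TopologicalSpace X] [MeasurableSpace X]
    [OpensMeasurableSpace X] (A : Set X) : Set X :=
  ⋃₀ {U : Set X | IsOpen U ∧ ResiduallyNull (U ∩ A)}

/-- `CROp A = X \ ROp A`. -/
def CROp {X : Type*} [TopologicalSpace X] [MeasurableSpace X]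
    [OpensMeasurableSpace X] (A : Set X) : Set X :=
  (ROp A)ᶜ

section

variable {X : Type*} [TopologicalSpace X] [MeasurableSpace X]

theorem ResiduallyNull.mono [OpensMeasurableSpace X] {A B : Set X} (hB : ResiduallyNull B)
    (h : A ⊆ B) : ResiduallyNull A :=
  Filter.mem_of_superset hB fun _ hμ => measure_mono_null h hμ

theorem ResiduallyNull.biUnion [OpensMeasurableSpace X] {ι : Type*} {s : Set ι}
    (hs : s.Countable) {A : ι → Set X} (h : ∀ i ∈ s, ResiduallyNull (A i)) :
    ResiduallyNull (⋃ i ∈ s, A i) := by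
  refine Filter.mem_of_superset ((countable_bInter_mem hs).2 h) fun μ hμ => ?_
  exact (measure_biUnion_null_iff hs).2 fun i hi => mem_iInter₂.1 hμ i hi

theorem ResiduallyNull.union [OpensMeasurableSpace X] {A B : Set X} (hA : ResiduallyNull A)
    (hB : ResiduallyNull B) : ResiduallyNull (A ∪ B) :=
  Filter.mem_of_superset (Filter.inter_mem hA hB) fun _ hμ => measure_union_null hμ.1 hμ.2

theorem isOpen_setOf_measure_lt [OpensMeasurableSpace X] [HasOuterApproxClosed X] {F : Set X}
    (hF : IsClosed F) (ε : ℝ≥0∞) : IsOpen {μ : ProbabilityMeasure X | μ.toMeasure F < ε} := by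
  refine isOpen_iff_mem_nhds.2 fun μ hμ => ?_
  exact Filter.eventually_lt_of_limsup_lt <|
    (ProbabilityMeasure.limsup_measure_closed_le_of_tendsto Filter.tendsto_id hF).trans_lt hμ

theorem tendsto_map_of_tendsto_pointwise_id [BorelSpace X] (μ : ProbabilityMeasure X)
    {f : ℕ → X → X} (hf : ∀ n, Measurable (f n))
    (hlim : ∀ x, Filter.Tendsto (fun n => f n x) Filter.atTop (𝓝 x)) :
    Filter.Tendsto (fun n => μ.map (hf n).aemeasurable) Filter.atTop (𝓝 μ) := by
  refine ProbabilityMeasure.tendsto_iff_forall_integral_tendsto.2 fun g => ?_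
  have hmap (n : ℕ) : ∫ x, g x ∂((μ.map (hf n).aemeasurable : ProbabilityMeasure X) : Measure X)
      = ∫ x, g (f n x) ∂(μ : Measure X) := by
    rw [ProbabilityMeasure.toMeasure_map]
    exact integral_map (hf n).aemeasurable g.continuous.measurable.aestronglyMeasurable
  simp only [hmap]
  refine tendsto_integral_of_dominated_convergence (fun _ => ‖g‖) (fun n => ?_)
    (integrable_const _) (fun n => ?_) ?_
  · exact (g.continuous.measurable.comp (hf n)).aestronglyMeasurable
  · exact Filter.Eventually.of_forall fun x => g.norm_coe_le_norm _
  · exact Filter.Eventually.of_forall fun x => (g.continuous.tendsto x).comp (hlim x)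

/-- Probability measures vanishing on the complement of a dense set are dense: push a given
measure forward along simple functions with values in the dense set converging to the identity. -/
theorem dense_annihilator_compl [PolishSpace X] [BorelSpace X] {D : Set X}
    (hD : Dense D) : Dense (Annihilator Dᶜ) := by
  intro μ
  let _ := TopologicalSpace.upgradeIsCompletelyMetrizable X
  have := μ.nonempty
  obtain ⟨y, hy⟩ := hD.nonempty
  let f (n : ℕ) := SimpleFunc.approxOn (id : X → X) measurable_id D y hy n
  have hf (n : ℕ) : Measurable (f n) := (f n).measurable
  refine mem_closure_of_tendsto (tendsto_map_of_tendsto_pointwise_id μ hf fun x =>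
    SimpleFunc.tendsto_approxOn measurable_id hy (hD x)) (Filter.Eventually.of_forall fun n => ?_)
  have hmem : ∀ᵐ x ∂(μ : Measure X).map (f n), x ∈ D := by
    refine (ae_map_mem_range (f n) (f n).finite_range.measurableSet _).mono ?_
    rintro _ ⟨x, rfl⟩
    exact SimpleFunc.approxOn_mem measurable_id hy n x
  exact hmem

theorem residuallyNull_of_isClosed_of_interior_eq_empty [PolishSpace X] [BorelSpace X]
    {F : Set X} (hF : IsClosed F) (hempty : interior F = ∅) : ResiduallyNull F := by
  let _ := TopologicalSpace.upgradeIsCompletelyMetrizable X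
  have hdense : Dense (Annihilator F) := by
    simpa using dense_annihilator_compl (interior_eq_empty_iff_dense_compl.1 hempty)
  have hmem (n : ℕ) : {μ : ProbabilityMeasure X | μ.toMeasure F < (n : ℝ≥0∞)⁻¹} ∈
      residual (ProbabilityMeasure X) := by
    refine residual_of_dense_open (isOpen_setOf_measure_lt hF _) (hdense.mono fun μ hμ => ?_)
    change μ.toMeasure F < _
    rw [show μ.toMeasure F = 0 from hμ]
    simp
  refine Filter.mem_of_superset (countable_iInter_mem.2 hmem) fun μ hμ => ?_
  by_contra hne
  obtain ⟨n, hn⟩ := ENNReal.exists_inv_nat_lt hne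
  exact lt_asymm hn (mem_iInter.1 hμ n)

theorem isOpen_ROp [OpensMeasurableSpace X] (A : Set X) : IsOpen (ROp A) :=
  isOpen_sUnion fun _ hU => hU.1

theorem residuallyNull_inter_ROp_of_secondCountable [SecondCountableTopology X]
    [OpensMeasurableSpace X] (A : Set X) : ResiduallyNull (A ∩ ROp A) := by
  obtain ⟨T, hTc, hTs, hT⟩ := TopologicalSpace.isOpen_sUnion_countable
    {U : Set X | IsOpen U ∧ ResiduallyNull (U ∩ A)} fun _ hU => hU.1
  refine (ResiduallyNull.biUnion hTc fun U hU => (hTs hU).2).mono ?_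
  rw [ROp, ← hT]
  rintro x ⟨hxA, U, hU, hxU⟩
  exact mem_biUnion hU ⟨hxU, hxA⟩

end

/-- For any `A ⊆ X`, both `A ∩ R(A)` and `A ∩ cl(R(A))` are residually null. -/
theorem residuallyNull_inter_ROp {X : Type*} [TopologicalSpace X] [PolishSpace X]
    [MeasurableSpace X] [BorelSpace X] (A : Set X) :
    ResiduallyNull (A ∩ ROp A) ∧ ResiduallyNull (A ∩ closure (ROp A)) := by
  have hR := residuallyNull_inter_ROp_of_secondCountable A
  have hempty : interior (frontier (ROp A)) = ∅ := by
    rw [← frontier_compl]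
    exact interior_frontier (isOpen_ROp A).isClosed_compl
  refine ⟨hR, (hR.union
    (residuallyNull_of_isClosed_of_interior_eq_empty isClosed_frontier hempty)).mono ?_⟩
  rintro x ⟨hxA, hx⟩
  rw [closure_eq_self_union_frontier] at hx
  exact hx.imp (fun h => ⟨hxA, h⟩) id
end
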